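/- Gauge invariance of the linearized Bach tensor: for n = 4, every smooth symmetric field h_{μν} : ℝ^4 → ℝ, and all smooth parameters ξ_μ : ℝ^4 → ℝ and φ : ℝ^4 → ℝ, setting h^{ξ,φ}_{μν} = h_{μν} + ∂_μξ_ν + ∂_νξ_μ + 2φη_{μν}, one has ℬ^{αβ}[h^{ξ,φ}] = ℬ^{αβ}[h] for all α,β and all points. -/

import Mathlib

noncomputable section

open MeasureTheory

/-- Minkowski metric `diag(-1,1,…,1)` on `Fin n`. -/
def eta (n : ℕ) (μ ν : Fin n) : ℝ :=
  if μ = ν then (if (μ : ℕ) = 0 then -1 else 1) else 0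

/-- Partial derivative in the coordinate direction `μ`. -/
def pd {n : ℕ} (μ : Fin n) (f : (Fin n → ℝ) → ℝ) : (Fin n → ℝ) → ℝ :=
  fun x => fderiv ℝ f x (Pi.single μ 1)

/-- A rank-2 covariant field on `ℝ^n`. -/
abbrev TensorField (n : ℕ) := Fin n → Fin n → (Fin n → ℝ) → ℝ

/-- Linearized Riemann tensor
`ℛ_{αβγδ}[h] = −(1/2)(∂_α∂_γ h_{βδ} + ∂_β∂_δ h_{αγ} − ∂_α∂_δ h_{βγ} − ∂_β∂_γ h_{αδ})`. -/
def Riem {n : ℕ} (h : TensorField n) (α β γ δ : Fin n) : (Fin n → ℝ) → ℝ :=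
  fun x => -(1/2) * (pd α (pd γ (h β δ)) x + pd β (pd δ (h α γ)) x
    - pd α (pd δ (h β γ)) x - pd β (pd γ (h α δ)) x)

/-- Linearized Ricci tensor
`ℛ_{μν}[h] = (1/2) η^{αλ}(∂_μ∂_α h_{λν} − ∂_λ∂_α h_{μν} − ∂_μ∂_ν h_{λα} + ∂_λ∂_ν h_{μα})`. -/
def Ricci {n : ℕ} (h : TensorField n) (μ ν : Fin n) : (Fin n → ℝ) → ℝ :=
  fun x => (1/2) * ∑ α, ∑ l, eta n α l *
    (pd μ (pd α (h l ν)) x - pd l (pd α (h μ ν)) x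
      - pd μ (pd ν (h l α)) x + pd l (pd ν (h μ α)) x)

/-- Linearized scalar curvature `ℛ[h] = η^{αλ}η^{μν}(∂_λ∂_ν h_{μα} − ∂_α∂_λ h_{μν})`. -/
def Scal {n : ℕ} (h : TensorField n) : (Fin n → ℝ) → ℝ :=
  fun x => ∑ α, ∑ l, ∑ μ, ∑ ν, eta n α l * eta n μ ν *
    (pd l (pd ν (h μ α)) x - pd α (pd l (h μ ν)) x)

/-- Linearized Schouten-type tensor
`𝒦_{μν}[h] = (1/(n−2))(ℛ_{μν}[h] − η_{μν}ℛ[h]/(2(n−1)))`. -/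
def Kt {n : ℕ} (h : TensorField n) (μ ν : Fin n) : (Fin n → ℝ) → ℝ :=
  fun x => (1 / ((n : ℝ) - 2)) *
    (Ricci h μ ν x - eta n μ ν * Scal h x / (2 * ((n : ℝ) - 1)))

/-- Linearized Weyl tensor
`𝒲_{αβγδ}[h] = ℛ_{αβγδ}[h] − η_{αγ}𝒦_{δβ}[h] + η_{αδ}𝒦_{γβ}[h] + η_{βγ}𝒦_{δα}[h] − η_{βδ}𝒦_{γα}[h]`. -/
def Weyl {n : ℕ} (h : TensorField n) (α β γ δ : Fin n) : (Fin n → ℝ) → ℝ :=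
  fun x => Riem h α β γ δ x - eta n α γ * Kt h δ β x + eta n α δ * Kt h γ β x
    + eta n β γ * Kt h δ α x - eta n β δ * Kt h γ α x

/-- Linearized Cotton tensor `𝒞_{αβμ}[h] = ∂_μ𝒦_{βα}[h] − ∂_β𝒦_{μα}[h]`. -/
def Cotton {n : ℕ} (h : TensorField n) (α β μ : Fin n) : (Fin n → ℝ) → ℝ :=
  fun x => pd μ (Kt h β α) x - pd β (Kt h μ α) x

/-- Cotton tensor with all indices raised:
`𝒞^{αβρ}[h] = η^{αα'}η^{ββ'}η^{ρρ'}𝒞_{α'β'ρ'}[h]`. -/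
def CottonUp {n : ℕ} (h : TensorField n) (α β ρ : Fin n) : (Fin n → ℝ) → ℝ :=
  fun x => ∑ α', ∑ β', ∑ ρ', eta n α α' * eta n β β' * eta n ρ ρ' * Cotton h α' β' ρ' x

/-- Linearized Bach tensor `ℬ^{αβ}[h] = −2∂_ρ𝒞^{αβρ}[h]`. -/
def Bach {n : ℕ} (h : TensorField n) (α β : Fin n) : (Fin n → ℝ) → ℝ :=
  fun x => -2 * ∑ ρ, pd ρ (CottonUp h α β ρ) x

/-- The metric sign attached to a coordinate direction. -/
def metricSign {n : ℕ} (μ : Fin n) : ℝ := eta n μ μ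

lemma metricSign_mul_self {n : ℕ} (μ : Fin n) : metricSign μ * metricSign μ = 1 := by
  unfold metricSign eta
  split_ifs <;> norm_num at *

lemma eta_eq {n : ℕ} (μ ν : Fin n) : eta n μ ν = if μ = ν then metricSign μ else 0 := by
  unfold metricSign eta
  split_ifs <;> simp_all

lemma sum_eta_mul {n : ℕ} (α : Fin n) (F : Fin n → ℝ) :
    ∑ l, eta n α l * F l = metricSign α * F α := by
  simp [eta_eq]

lemma contDiff_pd {n : ℕ} {f : (Fin n → ℝ) → ℝ} (hf : ContDiff ℝ (⊤ : ℕ∞) f) (μ : Fin n) :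
    ContDiff ℝ (⊤ : ℕ∞) (pd μ f) :=
  (hf.fderiv_right (m := (⊤ : ℕ∞)) (by simp)).clm_apply contDiff_const

lemma ContDiff.differentiable_of_top {n : ℕ} {f : (Fin n → ℝ) → ℝ}
    (hf : ContDiff ℝ (⊤ : ℕ∞) f) : Differentiable ℝ f :=
  hf.differentiable (by simp)

lemma pd_add {n : ℕ} {f g : (Fin n → ℝ) → ℝ} (hf : ContDiff ℝ (⊤ : ℕ∞) f)
    (hg : ContDiff ℝ (⊤ : ℕ∞) g) (μ : Fin n) :
    pd μ (fun x => f x + g x) = fun x => pd μ f x + pd μ g x := by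
  funext x
  simp [pd, fderiv_fun_add (hf.differentiable_of_top x) (hg.differentiable_of_top x)]

lemma pd_sub {n : ℕ} {f g : (Fin n → ℝ) → ℝ} (hf : ContDiff ℝ (⊤ : ℕ∞) f)
    (hg : ContDiff ℝ (⊤ : ℕ∞) g) (μ : Fin n) :
    pd μ (fun x => f x - g x) = fun x => pd μ f x - pd μ g x := by
  funext x
  simp [pd, fderiv_fun_sub (hf.differentiable_of_top x) (hg.differentiable_of_top x)]

lemma pd_const_mul_mul_const {n : ℕ} {f : (Fin n → ℝ) → ℝ} (hf : ContDiff ℝ (⊤ : ℕ∞) f)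
    (a b : ℝ) (μ : Fin n) :
    pd μ (fun x => a * f x * b) = fun x => a * pd μ f x * b := by
  funext x
  have hd := hf.differentiable_of_top x
  simp only [pd]
  rw [fderiv_mul_const (hd.const_mul a), fderiv_const_mul hd]
  simp
  ring

lemma pd_comm {n : ℕ} {f : (Fin n → ℝ) → ℝ} (hf : ContDiff ℝ (⊤ : ℕ∞) f) (μ ν : Fin n) :
    pd μ (pd ν f) = pd ν (pd μ f) := by
  funext x
  have hd : DifferentiableAt ℝ (fderiv ℝ f) x :=
    (hf.fderiv_right (m := (⊤ : ℕ∞)) (by simp)).differentiable (by simp) x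
  have hs : IsSymmSndFDerivAt ℝ f x :=
    hf.contDiffAt.isSymmSndFDerivAt <| by
      rw [minSmoothness_of_isRCLikeNormedField]
      exact WithTop.coe_le_coe.2 (le_top (a := (2 : ℕ∞)))
  unfold pd
  rw [fderiv_clm_apply hd (differentiableAt_const _), fderiv_clm_apply hd (differentiableAt_const _)]
  simpa using hs (Pi.single μ 1) (Pi.single ν 1)

/-- The linearized gauge transform of `h` with parameters `ξ` and `φ`. -/
def gaugeTransform {n : ℕ} (h : TensorField n) (ξ : Fin n → (Fin n → ℝ) → ℝ)
    (φ : (Fin n → ℝ) → ℝ) : TensorField n :=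
  fun μ ν x => h μ ν x + pd μ (ξ ν) x + pd ν (ξ μ) x + 2 * φ x * eta n μ ν

section Gauge

variable {n : ℕ} {h : TensorField n} {ξ : Fin n → (Fin n → ℝ) → ℝ} {φ : (Fin n → ℝ) → ℝ}

lemma pd_pd_gaugeTransform (hh : ∀ μ ν, ContDiff ℝ (⊤ : ℕ∞) (h μ ν))
    (hξ : ∀ μ, ContDiff ℝ (⊤ : ℕ∞) (ξ μ)) (hφ : ContDiff ℝ (⊤ : ℕ∞) φ)
    (a b μ ν : Fin n) (x : Fin n → ℝ) :
    pd a (pd b (gaugeTransform h ξ φ μ ν)) x =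
      pd a (pd b (h μ ν)) x + pd a (pd b (pd μ (ξ ν))) x + pd a (pd b (pd ν (ξ μ))) x
        + 2 * pd a (pd b φ) x * eta n μ ν := by
  have h₁ := hh μ ν
  have h₂ := contDiff_pd (hξ ν) μ
  have h₃ := contDiff_pd (hξ μ) ν
  have h₄ := contDiff_pd h₁ b
  have h₅ := contDiff_pd h₂ b
  have h₆ := contDiff_pd h₃ b
  have h₇ := contDiff_pd hφ b
  unfold gaugeTransform
  rw [pd_add (by fun_prop) (by fun_prop), pd_add (by fun_prop) h₃, pd_add h₁ h₂,
    pd_const_mul_mul_const hφ, pd_add (by fun_prop) (by fun_prop), pd_add (by fun_prop) h₆,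
    pd_add h₄ h₅, pd_const_mul_mul_const h₇]

/-- The flat d'Alembertian. -/
def dAlembertian (φ : (Fin n → ℝ) → ℝ) : (Fin n → ℝ) → ℝ :=
  fun x => ∑ α, metricSign α * pd α (pd α φ) x

lemma Ricci_eq (h : TensorField n) (μ ν : Fin n) (x : Fin n → ℝ) :
    Ricci h μ ν x = (1 / 2) * ∑ α, metricSign α *
      (pd μ (pd α (h α ν)) x - pd α (pd α (h μ ν)) x
        - pd μ (pd ν (h α α)) x + pd α (pd ν (h μ α)) x) := by
  simp only [Ricci, sum_eta_mul]

lemma Scal_eq (h : TensorField n) (x : Fin n → ℝ) :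
    Scal h x = ∑ α, ∑ μ, metricSign α * metricSign μ *
      (pd α (pd μ (h μ α)) x - pd α (pd α (h μ μ)) x) := by
  simp only [Scal, mul_assoc, ← Finset.mul_sum, sum_eta_mul]

lemma Ricci_gaugeTransform (hh : ∀ μ ν, ContDiff ℝ (⊤ : ℕ∞) (h μ ν))
    (hξ : ∀ μ, ContDiff ℝ (⊤ : ℕ∞) (ξ μ)) (hφ : ContDiff ℝ (⊤ : ℕ∞) φ)
    (μ ν : Fin n) (x : Fin n → ℝ) :
    Ricci (gaugeTransform h ξ φ) μ ν x =
      Ricci h μ ν x - ((n : ℝ) - 2) * pd μ (pd ν φ) x - eta n μ ν * dAlembertian φ x := by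
  have key : ∀ α, metricSign α *
      (pd μ (pd α (gaugeTransform h ξ φ α ν)) x - pd α (pd α (gaugeTransform h ξ φ μ ν)) x
        - pd μ (pd ν (gaugeTransform h ξ φ α α)) x + pd α (pd ν (gaugeTransform h ξ φ μ α)) x)
      = metricSign α * (pd μ (pd α (h α ν)) x - pd α (pd α (h μ ν)) x
        - pd μ (pd ν (h α α)) x + pd α (pd ν (h μ α)) x)
        + ((if α = ν then 2 * pd μ (pd ν φ) x else 0)
          - 2 * eta n μ ν * (metricSign α * pd α (pd α φ) x)
          - 2 * pd μ (pd ν φ) x + (if μ = α then 2 * pd μ (pd ν φ) x else 0)) := by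
    intro α
    simp only [pd_pd_gaugeTransform hh hξ hφ]
    have e₁ : pd μ (pd α (pd α (ξ ν))) = pd α (pd α (pd μ (ξ ν))) := by
      rw [pd_comm (contDiff_pd (hξ ν) α), pd_comm (hξ ν) μ α]
    have e₂ : pd α (pd ν (pd μ (ξ α))) = pd μ (pd ν (pd α (ξ α))) := by
      rw [pd_comm (hξ α) ν μ, pd_comm (contDiff_pd (hξ α) ν) α μ, pd_comm (hξ α) α ν]
    have e₃ : pd μ (pd α (pd ν (ξ α))) = pd μ (pd ν (pd α (ξ α))) := by
      rw [pd_comm (hξ α) α ν]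
    have e₄ : pd α (pd ν (pd α (ξ μ))) = pd α (pd α (pd ν (ξ μ))) := by
      rw [pd_comm (hξ μ) ν α]
    have s := metricSign_mul_self α
    have d : metricSign α * eta n α α = 1 := s
    have t₁ : metricSign α * (pd μ (pd α φ) x * eta n α ν)
        = if α = ν then pd μ (pd ν φ) x else 0 := by
      rw [eta_eq]
      split_ifs with hc
      · subst hc; linear_combination pd μ (pd α φ) x * s
      · simp
    have t₂ : metricSign α * (pd α (pd ν φ) x * eta n μ α)
        = if μ = α then pd μ (pd ν φ) x else 0 := by
      rw [eta_eq]
      split_ifs with hc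
      · subst hc; linear_combination pd μ (pd ν φ) x * s
      · simp
    rw [e₁, e₂, e₃, e₄]
    have r : ∀ (p : Prop) [Decidable p] (y : ℝ),
        (if p then 2 * y else 0) = 2 * (if p then y else 0) := by
      intro p _ y; split_ifs <;> simp
    rw [r, r, ← t₁, ← t₂]
    linear_combination (-2 * pd μ (pd ν φ) x) * d
  rw [Ricci_eq, Ricci_eq, Finset.sum_congr rfl fun α _ => key α]
  simp only [Finset.sum_add_distrib, Finset.sum_sub_distrib, ← Finset.mul_sum, dAlembertian]
  simp
  ring

lemma Scal_gaugeTransform (hh : ∀ μ ν, ContDiff ℝ (⊤ : ℕ∞) (h μ ν))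
    (hξ : ∀ μ, ContDiff ℝ (⊤ : ℕ∞) (ξ μ)) (hφ : ContDiff ℝ (⊤ : ℕ∞) φ) (x : Fin n → ℝ) :
    Scal (gaugeTransform h ξ φ) x = Scal h x - 2 * ((n : ℝ) - 1) * dAlembertian φ x := by
  have key : ∀ α μ, metricSign α * metricSign μ *
      (pd α (pd μ (gaugeTransform h ξ φ μ α)) x - pd α (pd α (gaugeTransform h ξ φ μ μ)) x)
      = metricSign α * metricSign μ * (pd α (pd μ (h μ α)) x - pd α (pd α (h μ μ)) x)
        + (metricSign μ * metricSign α * pd μ (pd μ (pd α (ξ α))) x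
          - metricSign α * metricSign μ * pd α (pd α (pd μ (ξ μ))) x
          + (if μ = α then 2 * (metricSign α * pd α (pd α φ) x) else 0)
          - 2 * (metricSign α * pd α (pd α φ) x)) := by
    intro α μ
    simp only [pd_pd_gaugeTransform hh hξ hφ]
    have e₁ : pd α (pd μ (pd μ (ξ α))) = pd μ (pd μ (pd α (ξ α))) := by
      rw [pd_comm (contDiff_pd (hξ α) μ), pd_comm (hξ α) α μ]
    have e₂ : pd α (pd μ (pd α (ξ μ))) = pd α (pd α (pd μ (ξ μ))) := by
      rw [pd_comm (hξ μ) μ α]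
    have d : metricSign μ * eta n μ μ = 1 := metricSign_mul_self μ
    have t : metricSign μ * (pd α (pd μ φ) x * eta n μ α)
        = if μ = α then pd α (pd α φ) x else 0 := by
      rw [eta_eq]
      split_ifs with hc
      · subst hc; linear_combination pd μ (pd μ φ) x * metricSign_mul_self μ
      · simp
    have r : (if μ = α then 2 * (metricSign α * pd α (pd α φ) x) else 0)
        = 2 * metricSign α * (if μ = α then pd α (pd α φ) x else 0) := by
      split_ifs <;> ring
    rw [e₁, e₂, r, ← t]
    linear_combination (-2 * metricSign α * pd α (pd α φ) x) * d
  rw [Scal_eq, Scal_eq, Finset.sum_congr rfl fun α _ => Finset.sum_congr rfl fun μ _ => key α μ]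
  simp only [Finset.sum_add_distrib, Finset.sum_sub_distrib]
  rw [Finset.sum_comm (f := fun α μ => metricSign μ * metricSign α * pd μ (pd μ (pd α (ξ α))) x)]
  simp [dAlembertian, ← Finset.mul_sum]
  ring

/-- The Schouten-type tensor changes only by the Hessian of the Weyl parameter. -/
lemma Kt_gaugeTransform (hn : 3 ≤ n) (hh : ∀ μ ν, ContDiff ℝ (⊤ : ℕ∞) (h μ ν))
    (hξ : ∀ μ, ContDiff ℝ (⊤ : ℕ∞) (ξ μ)) (hφ : ContDiff ℝ (⊤ : ℕ∞) φ) (μ ν : Fin n) :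
    Kt (gaugeTransform h ξ φ) μ ν = fun x => Kt h μ ν x - pd μ (pd ν φ) x := by
  funext x
  have hn' : (3 : ℝ) ≤ n := by exact_mod_cast hn
  have h₁ : (n : ℝ) - 1 ≠ 0 := by linarith
  have h₂ : (n : ℝ) - 2 ≠ 0 := by linarith
  simp only [Kt, Ricci_gaugeTransform hh hξ hφ, Scal_gaugeTransform hh hξ hφ]
  field_simp
  ring

lemma contDiff_Kt (hh : ∀ μ ν, ContDiff ℝ (⊤ : ℕ∞) (h μ ν)) (μ ν : Fin n) :
    ContDiff ℝ (⊤ : ℕ∞) (Kt h μ ν) := by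
  have hpd : ∀ a b μ ν, ContDiff ℝ (⊤ : ℕ∞) (pd a (pd b (h μ ν))) :=
    fun a b μ ν => contDiff_pd (contDiff_pd (hh μ ν) b) a
  unfold Kt Ricci Scal
  fun_prop

/-- The linearized Cotton tensor is gauge invariant. -/
lemma Cotton_gaugeTransform (hn : 3 ≤ n) (hh : ∀ μ ν, ContDiff ℝ (⊤ : ℕ∞) (h μ ν))
    (hξ : ∀ μ, ContDiff ℝ (⊤ : ℕ∞) (ξ μ)) (hφ : ContDiff ℝ (⊤ : ℕ∞) φ) :
    Cotton (gaugeTransform h ξ φ) = Cotton h := by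
  funext α β μ x
  have hpd : ∀ a b, ContDiff ℝ (⊤ : ℕ∞) (pd a (pd b φ)) :=
    fun a b => contDiff_pd (contDiff_pd hφ b) a
  simp only [Cotton, Kt_gaugeTransform hn hh hξ hφ, pd_sub (contDiff_Kt hh _ _) (hpd _ _)]
  rw [pd_comm (contDiff_pd hφ α) μ β]
  ring

end Gauge

/-- gauge invariance of the linearized Bach tensor under
`h^{ξ,φ}_{μν} = h_{μν} + ∂_μξ_ν + ∂_νξ_μ + 2φη_{μν}` in four dimensions. -/
theorem bach_tensor_gauge_invariant
    (h : TensorField 4) (hsmooth : ∀ μ ν, ContDiff ℝ (⊤ : ℕ∞) (h μ ν))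
    (hsym : ∀ μ ν, h μ ν = h ν μ)
    (ξ : Fin 4 → (Fin 4 → ℝ) → ℝ) (hξ : ∀ μ, ContDiff ℝ (⊤ : ℕ∞) (ξ μ))
    (φ : (Fin 4 → ℝ) → ℝ) (hφ : ContDiff ℝ (⊤ : ℕ∞) φ) :
    ∀ (α β : Fin 4) (x : Fin 4 → ℝ),
      Bach (fun μ ν x => h μ ν x + pd μ (ξ ν) x + pd ν (ξ μ) x + 2 * φ x * eta 4 μ ν)
          α β x
        = Bach h α β x := by
  intro α β x
  have hC := Cotton_gaugeTransform (by norm_num) hsmooth hξ hφ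
  change Bach (gaugeTransform h ξ φ) α β x = Bach h α β x
  unfold Bach CottonUp
  rw [hC]
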